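/- Suppose W, V are invertible n×n complex matrices such that Wᴴ A V = diag(Λ, I) and Wᴴ E V = diag(I, 0), where Λ is an ñ×ñ diagonal matrix with diagonal entries λ₁,…,λ_ñ. Then for every s ∈ ℂ not equal to any λⱼ, the transfer function H(s) = C(sE − A)⁻¹B + D satisfies H(s) = Σⱼ (C vⱼ)(wⱼᴴ B)/(s − λⱼ) + M_∞ + D, where vⱼ, wⱼ are the j-th columns of V, W respectively, and M_∞ = −(C V_∞)(W_∞ᴴ B) with V_∞, W_∞ the last n − ñ columns of V, W. -/

import Mathlib

open Matrix

/-- Partial fraction expansion of the transfer function via the Kronecker canonical form. -/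
theorem transfer_function_partial_fractions {nt k m p : ℕ}
    (A E : Matrix (Fin nt ⊕ Fin k) (Fin nt ⊕ Fin k) ℂ)
    (B : Matrix (Fin nt ⊕ Fin k) (Fin m) ℂ)
    (C : Matrix (Fin p) (Fin nt ⊕ Fin k) ℂ)
    (D : Matrix (Fin p) (Fin m) ℂ)
    (W V : Matrix (Fin nt ⊕ Fin k) (Fin nt ⊕ Fin k) ℂ)
    (hW : IsUnit W.det) (hV : IsUnit V.det)
    (lam : Fin nt → ℂ)
    (hA : Wᴴ * A * V = Matrix.fromBlocks (Matrix.diagonal lam) 0 0 1)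
    (hE : Wᴴ * E * V = Matrix.fromBlocks 1 0 0 0) :
    ∀ s : ℂ, (∀ j : Fin nt, s ≠ lam j) →
      C * (s • E - A)⁻¹ * B + D =
        (∑ j : Fin nt, (s - lam j)⁻¹ •
            Matrix.vecMulVec (C *ᵥ (fun i => V i (Sum.inl j)))
              (Matrix.vecMul (star (fun i => W i (Sum.inl j))) B)) +
          (-(C * V.submatrix id Sum.inr) * ((W.submatrix id Sum.inr)ᴴ * B)) + D := by
  intro s hs
  set d : Fin nt ⊕ Fin k → ℂ := Sum.elim (fun j => (s - lam j)⁻¹) (fun _ => -1) with hd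
  have hpencil : Wᴴ * (s • E - A) * V =
      diagonal (Sum.elim (fun j => s - lam j) (fun _ => -1)) := by
    rw [Matrix.mul_sub, Matrix.sub_mul, Matrix.mul_smul, Matrix.smul_mul, hA, hE]
    ext (i | i) (j | j)
    · by_cases h : i = j <;> simp [h]
    · simp
    · simp
    · by_cases h : i = j <;> simp [h]
  have hdiag : Wᴴ * ((s • E - A) * V * diagonal d) = 1 := by
    rw [← Matrix.mul_assoc, ← Matrix.mul_assoc, hpencil, diagonal_mul_diagonal,
      ← diagonal_one]
    congr 1
    ext (j | j)
    · simp [hd, mul_inv_cancel₀ (sub_ne_zero.mpr (hs j))]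
    · simp [hd]
  have hinv : (s • E - A)⁻¹ = V * diagonal d * Wᴴ := by
    apply Matrix.inv_eq_right_inv
    rw [← Matrix.mul_assoc, ← Matrix.mul_assoc]
    exact mul_eq_one_comm.mp hdiag
  have hfactor : C * (V * diagonal d * Wᴴ) * B = (C * V) * diagonal d * (Wᴴ * B) := by
    simp only [Matrix.mul_assoc]
  rw [hinv, hfactor]
  congr 1
  ext i j
  rw [Matrix.mul_apply, Fintype.sum_sum_type, Matrix.add_apply, Matrix.sum_apply]
  congr 1
  · refine Finset.sum_congr rfl fun x _ => ?_
    rw [mul_diagonal, Matrix.smul_apply, vecMulVec_apply, smul_eq_mul, mul_comm _ (d _),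
      mul_assoc]
    rfl
  · rw [Matrix.mul_apply]
    refine Finset.sum_congr rfl fun x _ => ?_
    rw [mul_diagonal, Matrix.neg_apply]
    simp only [hd, Sum.elim_inr, mul_neg, mul_one]
    rfl
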